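/- arXiv:1307.4948 — 2 statements merged into one kernel-verified Lean document; each statement's English description precedes it below -/
import Mathlib

section
/- Let f and φ be Lebesgue-measurable functions on ℝⁿ such that |f(x)| ≤ β for all x and f vanishes outside a measurable set E of Lebesgue measure r. Then for every t > 0, (f∗φ)**(t) ≤ β · r · φ**(t). -/
open MeasureTheory Set
open scoped ENNReal

/-- Distribution function: `μ {x : |f x| > s}`. -/
noncomputable def distrib {X : Type*} [MeasurableSpace X] (μ : Measure X)
    (f : X → ℝ) (s : ℝ) : ℝ≥0∞ :=
  μ {x | s < |f x|}

/-- Decreasing rearrangement: `f*(t) = inf {s > 0 : λ_f(s) ≤ t}`. -/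
noncomputable def rearr {X : Type*} [MeasurableSpace X] (μ : Measure X)
    (f : X → ℝ) (t : ℝ) : ℝ≥0∞ :=
  ⨅ (s : ℝ) (_ : 0 < s ∧ distrib μ f s ≤ ENNReal.ofReal t), ENNReal.ofReal s

/-- Maximal function `f**(t) = (1/t) ∫₀ᵗ f*(u) du`. -/
noncomputable def maxFn {X : Type*} [MeasurableSpace X] (μ : Measure X)
    (f : X → ℝ) (t : ℝ) : ℝ≥0∞ :=
  (ENNReal.ofReal t)⁻¹ * ∫⁻ u in Set.Ioc (0:ℝ) t, rearr μ f u

/-- Lorentz norm `‖f‖_{p,q}`; for `q = ∞` it is `sup_{t>0} t^{1/p} f**(t)`. -/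
noncomputable def lorentzNorm {X : Type*} [MeasurableSpace X] (μ : Measure X)
    (f : X → ℝ) (p : ℝ) (q : ℝ≥0∞) : ℝ≥0∞ :=
  if q = ⊤ then ⨆ (t : ℝ) (_ : 0 < t), ENNReal.ofReal t ^ (1/p) * maxFn μ f t
  else (∫⁻ t in Set.Ioi (0:ℝ),
      (ENNReal.ofReal t ^ (1/p) * maxFn μ f t) ^ q.toReal * (ENNReal.ofReal t)⁻¹) ^ (1 / q.toReal)

/-- Convolution on ℝⁿ: `(f ∗ g)(x) = ∫ f(x-y) g(y) dy`. -/
noncomputable def conv {n : ℕ} (f g : EuclideanSpace ℝ (Fin n) → ℝ)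
    (x : EuclideanSpace ℝ (Fin n)) : ℝ :=
  ∫ y, f (x - y) * g y

/-- `‖f‖_p = (∫ |f|^p dμ)^{1/p}`. -/
noncomputable def lpNorm {X : Type*} [MeasurableSpace X] (μ : Measure X)
    (f : X → ℝ) (p : ℝ) : ℝ≥0∞ :=
  (∫⁻ x, ENNReal.ofReal |f x| ^ p ∂μ) ^ (1/p)

/-- Riesz potential `I_α f(x) = ∫ |x-y|^{α-n} f(y) dy` on ℝⁿ. -/
noncomputable def riesz (n : ℕ) (α : ℝ) (f : EuclideanSpace ℝ (Fin n) → ℝ)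
    (x : EuclideanSpace ℝ (Fin n)) : ℝ :=
  ∫ y, ‖x - y‖ ^ (α - (n:ℝ)) * f y

theorem volume_Ioi_inter_ofReal_lt_add {c : ℝ} (hc : 0 ≤ c) (a : ℝ≥0∞) :
    volume (Ioi c ∩ {s : ℝ | ENNReal.ofReal s < ENNReal.ofReal c + a}) = a := by
  induction a with
  | top => simp
  | coe a =>
    have h : Ioi c ∩ {s : ℝ | ENNReal.ofReal s < ENNReal.ofReal c + a} = Ioo c (c + a) := by
      ext s
      simp only [mem_inter_iff, mem_Ioi, mem_ofPred_eq, mem_Ioo, and_congr_right_iff]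
      intro hs
      rw [← ENNReal.ofReal_coe_nnreal, ← ENNReal.ofReal_add hc a.coe_nonneg,
        ENNReal.ofReal_lt_ofReal_iff_of_nonneg (hc.trans hs.le)]
    rw [h, Real.volume_Ioo]
    simp

/-- Layer cake formula for the excess over the level `c`. -/
theorem setLIntegral_Ioi_measure_ofReal_lt_add {X : Type*} [MeasurableSpace X] (μ : Measure X)
    [SFinite μ] {c : ℝ} (hc : 0 ≤ c) {G : X → ℝ≥0∞} (hG : Measurable G) :
    ∫⁻ s in Ioi c, μ {x | ENNReal.ofReal s < ENNReal.ofReal c + G x} = ∫⁻ x, G x ∂μ := by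
  have hm : MeasurableSet {p : ℝ × X | ENNReal.ofReal p.1 < ENNReal.ofReal c + G p.2} :=
    measurableSet_lt (by fun_prop) (by fun_prop)
  have h1 := Measure.prod_apply (μ := volume.restrict (Ioi c)) (ν := μ) hm
  have h2 := Measure.prod_apply_symm (μ := volume.restrict (Ioi c)) (ν := μ) hm
  refine (h1.symm.trans h2).trans (lintegral_congr fun x => ?_)
  rw [Measure.restrict_apply (measurable_prodMk_right hm), inter_comm]
  exact volume_Ioi_inter_ofReal_lt_add hc (G x)

theorem distrib_antitone {X : Type*} [MeasurableSpace X] (μ : Measure X) (h : X → ℝ) :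
    Antitone (distrib μ h) :=
  fun _ _ hab => measure_mono fun _ hx => lt_of_le_of_lt hab hx

theorem rearr_eq_volume {X : Type*} [MeasurableSpace X] (μ : Measure X) (h : X → ℝ) (u : ℝ) :
    rearr μ h u = volume (Ioi 0 ∩ {s : ℝ | ENNReal.ofReal u < distrib μ h s}) := by
  apply le_antisymm
  · have h0 := volume_Ioi_inter_ofReal_lt_add le_rfl (rearr μ h u)
    refine h0.symm.le.trans (measure_mono fun s hs => ⟨hs.1, ?_⟩)
    by_contra! hle
    have hs2 := hs.2
    simp only [ENNReal.ofReal_zero, zero_add, mem_ofPred_eq] at hs2 hle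
    exact absurd hs2 (not_lt.2 (iInf₂_le s ⟨hs.1, not_lt.1 hle⟩))
  · refine le_iInf₂ fun s hs => ?_
    have hsub : Ioi 0 ∩ {s : ℝ | ENNReal.ofReal u < distrib μ h s} ⊆ Ioo 0 s := by
      refine fun s' hs' => ⟨hs'.1, ?_⟩
      by_contra! hle
      exact absurd (lt_of_lt_of_le hs'.2 (distrib_antitone μ h hle)) (not_lt.2 hs.2)
    simpa using (measure_mono hsub).trans_eq Real.volume_Ioo

theorem volume_ofReal_lt_inter_Ioc (t : ℝ) (a : ℝ≥0∞) :
    volume ({u : ℝ | ENNReal.ofReal u < a} ∩ Ioc 0 t) = min (ENNReal.ofReal t) a := by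
  induction a with
  | top => simp
  | coe a =>
    have h : ∀ u : ℝ, 0 < u → (ENNReal.ofReal u < a ↔ u < a) := fun u hu => by
      rw [← ENNReal.ofReal_coe_nnreal, ENNReal.ofReal_lt_ofReal_iff_of_nonneg hu.le]
    have h1 : Ioo 0 (min t a) ⊆ {u : ℝ | ENNReal.ofReal u < a} ∩ Ioc 0 t := fun u hu =>
      ⟨(h u hu.1).2 (hu.2.trans_le (min_le_right _ _)), hu.1, (hu.2.trans_le (min_le_left _ _)).le⟩
    have h2 : {u : ℝ | ENNReal.ofReal u < a} ∩ Ioc 0 t ⊆ Ioc 0 (min t a) := fun u hu =>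
      ⟨hu.2.1, le_min hu.2.2 ((h u hu.2.1).1 hu.1).le⟩
    have h3 : ENNReal.ofReal (min t a) = min (ENNReal.ofReal t) a := by
      rw [← ENNReal.ofReal_coe_nnreal]
      exact ENNReal.ofReal_mono.map_min
    rw [← h3]
    apply le_antisymm
    · simpa using measure_mono (μ := volume) h2
    · simpa using measure_mono (μ := volume) h1

theorem setLIntegral_rearr {X : Type*} [MeasurableSpace X] (μ : Measure X) (h : X → ℝ) (t : ℝ) :
    ∫⁻ u in Ioc 0 t, rearr μ h u =
      ∫⁻ s in Ioi 0, min (ENNReal.ofReal t) (distrib μ h s) := by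
  have hd : Measurable (distrib μ h) := (distrib_antitone μ h).measurable
  have hm : MeasurableSet {p : ℝ × ℝ | ENNReal.ofReal p.1 < distrib μ h p.2} :=
    measurableSet_lt (by fun_prop) (by fun_prop)
  have h1 := Measure.prod_apply (μ := volume.restrict (Ioc 0 t))
    (ν := volume.restrict (Ioi 0)) hm
  have h2 := Measure.prod_apply_symm (μ := volume.restrict (Ioc 0 t))
    (ν := volume.restrict (Ioi 0)) hm
  calc _ = _ := lintegral_congr fun u => by
        rw [rearr_eq_volume, inter_comm, ← Measure.restrict_apply]
        · rfl
        · exact measurable_prodMk_left hm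
    _ = _ := h1.symm.trans h2
    _ = _ := lintegral_congr fun s => by
        rw [Measure.restrict_apply (measurable_prodMk_right hm)]
        exact volume_ofReal_lt_inter_Ioc t (distrib μ h s)

theorem setLIntegral_rearr_le_of_enorm_le_add {X : Type*} [MeasurableSpace X] (μ : Measure X)
    [SFinite μ] {h : X → ℝ} {H : X → ℝ≥0∞} (hH : Measurable H) {c : ℝ} (hc : 0 ≤ c)
    (hle : ∀ x, ‖h x‖ₑ ≤ ENNReal.ofReal c + H x) (t : ℝ) :
    ∫⁻ u in Ioc 0 t, rearr μ h u ≤ ENNReal.ofReal t * ENNReal.ofReal c + ∫⁻ x, H x ∂μ := by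
  rw [setLIntegral_rearr, ← Ioc_union_Ioi_eq_Ioi hc,
    lintegral_union measurableSet_Ioi Ioc_disjoint_Ioi_same,
    ← setLIntegral_Ioi_measure_ofReal_lt_add μ hc hH]
  gcongr ?_ + ?_
  · calc _ ≤ ∫⁻ _ in Ioc 0 c, ENNReal.ofReal t := lintegral_mono fun _ => min_le_left _ _
      _ = _ := by simp
  · refine setLIntegral_mono' measurableSet_Ioi fun s hs => (min_le_right _ _).trans ?_
    refine measure_mono fun x hx => lt_of_lt_of_le ?_ (hle x)
    rw [Real.enorm_eq_ofReal_abs]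
    exact (ENNReal.ofReal_lt_ofReal_iff_of_nonneg (hc.trans (le_of_lt hs))).2 hx

/-- Either the integral of the rearrangement is infinite, or it is at least the value of the
`L¹ + L∞` splitting at a suitable height. -/
theorem setLIntegral_rearr_eq_top_or_exists_le {X : Type*} [MeasurableSpace X] (μ : Measure X)
    [SFinite μ] {φ : X → ℝ} (hφ : Measurable φ) {t : ℝ} (ht : 0 < t) :
    ∫⁻ u in Ioc 0 t, rearr μ φ u = ⊤ ∨ ∃ c : ℝ, 0 ≤ c ∧
      ENNReal.ofReal t * ENNReal.ofReal c + ∫⁻ x, ENNReal.ofReal (|φ x| - c) ∂μ ≤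
        ∫⁻ u in Ioc 0 t, rearr μ φ u := by
  rw [setLIntegral_rearr]
  rcases Set.eq_empty_or_nonempty {s : ℝ | 0 < s ∧ distrib μ φ s ≤ ENNReal.ofReal t} with he | hne
  · left
    have h : ∀ s ∈ Ioi (0 : ℝ), min (ENNReal.ofReal t) (distrib μ φ s) = ENNReal.ofReal t := by
      refine fun s hs => min_eq_left ?_
      by_contra! hlt
      exact Set.eq_empty_iff_forall_notMem.1 he s ⟨hs, hlt.le⟩
    rw [setLIntegral_congr_fun measurableSet_Ioi h]
    simp [ht]
  · right
    set S := {s : ℝ | 0 < s ∧ distrib μ φ s ≤ ENNReal.ofReal t}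
    have hc : 0 ≤ sInf S := Real.sInf_nonneg fun s hs => hs.1.le
    have hbdd : BddBelow S := ⟨0, fun s hs => hs.1.le⟩
    refine ⟨sInf S, hc, ?_⟩
    have hsub : Ioo 0 (sInf S) ∪ Ioi (sInf S) ⊆ Ioi 0 :=
      union_subset (fun s hs => hs.1) fun s hs => lt_of_le_of_lt hc hs
    refine le_trans ?_ (lintegral_mono_set hsub)
    rw [lintegral_union measurableSet_Ioi
      (Set.disjoint_left.2 fun s hs hs' => lt_asymm hs.2 hs'),
      ← setLIntegral_Ioi_measure_ofReal_lt_add μ hc (by fun_prop)]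
    gcongr ?_ + ?_
    · calc _ = ∫⁻ _ in Ioo 0 (sInf S), ENNReal.ofReal t := by simp
        _ ≤ _ := setLIntegral_mono' measurableSet_Ioo fun s hs => le_min le_rfl <| by
          by_contra! hlt
          exact absurd (csInf_le hbdd ⟨hs.1, hlt.le⟩) (not_le.2 hs.2)
    · refine setLIntegral_mono' measurableSet_Ioi fun s hs => ?_
      obtain ⟨s', hs', hlt⟩ := exists_lt_of_csInf_lt hne hs
      rw [min_eq_right ((distrib_antitone μ φ hlt.le).trans hs'.2)]
      refine measure_mono fun x hx => ?_
      simp only [mem_ofPred_eq] at hx ⊢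
      by_contra! hle
      refine absurd hx (not_lt.2 ?_)
      calc ENNReal.ofReal (sInf S) + ENNReal.ofReal (|φ x| - sInf S)
          = ENNReal.ofReal (sInf S + max (|φ x| - sInf S) 0) := by
            rw [ENNReal.ofReal_add hc (le_max_right _ _), ENNReal.ofReal_max]; simp
        _ ≤ ENNReal.ofReal s := ENNReal.ofReal_le_ofReal <| by
            have hs0 : sInf S < s := hs
            rcases max_cases (|φ x| - sInf S) 0 with h | h <;> linarith [h.1]

theorem enorm_conv_le_add {n : ℕ} {f φ : EuclideanSpace ℝ (Fin n) → ℝ} (hf : Measurable f)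
    (c : ℝ) (x : EuclideanSpace ℝ (Fin n)) :
    ‖conv f φ x‖ₑ ≤ (∫⁻ y, ‖f y‖ₑ) * ENNReal.ofReal c +
      ∫⁻ y, ‖f (x - y)‖ₑ * ENNReal.ofReal (|φ y| - c) := by
  calc ‖conv f φ x‖ₑ ≤ ∫⁻ y, ‖f (x - y) * φ y‖ₑ := enorm_integral_le_lintegral_enorm _
    _ ≤ ∫⁻ y, (‖f (x - y)‖ₑ * ENNReal.ofReal c + ‖f (x - y)‖ₑ * ENNReal.ofReal (|φ y| - c)) := by
        refine lintegral_mono fun y => ?_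
        rw [enorm_mul, ← mul_add]
        gcongr
        rw [Real.enorm_eq_ofReal_abs]
        refine le_trans (ENNReal.ofReal_le_ofReal ?_) ENNReal.ofReal_add_le
        linarith
    _ = _ := by
        rw [lintegral_add_left (by fun_prop), lintegral_mul_const _ (by fun_prop),
          lintegral_sub_left_eq_self (fun y => ‖f y‖ₑ) x]

theorem lintegral_lintegral_sub_mul {n : ℕ} {F G : EuclideanSpace ℝ (Fin n) → ℝ≥0∞}
    (hF : Measurable F) (hG : Measurable G) :
    ∫⁻ x, ∫⁻ y, F (x - y) * G y = (∫⁻ x, F x) * ∫⁻ y, G y := by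
  rw [lintegral_lintegral_swap (by fun_prop), ← lintegral_const_mul _ hG]
  refine lintegral_congr fun y => ?_
  rw [lintegral_mul_const _ (by fun_prop), lintegral_sub_right_eq_self F y]

/-- Convolution with an integrable function: `∫₀ᵗ (f∗φ)* ≤ ‖f‖₁ ∫₀ᵗ φ*`. -/
theorem setLIntegral_rearr_conv_le {n : ℕ} {f φ : EuclideanSpace ℝ (Fin n) → ℝ}
    (hf : Measurable f) (hφ : Measurable φ) (hfin : ∫⁻ x, ‖f x‖ₑ ≠ ⊤) {t : ℝ} (ht : 0 < t) :
    ∫⁻ u in Ioc 0 t, rearr volume (conv f φ) u ≤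
      (∫⁻ x, ‖f x‖ₑ) * ∫⁻ u in Ioc 0 t, rearr volume φ u := by
  have key : ∀ c : ℝ, 0 ≤ c → ∫⁻ u in Ioc 0 t, rearr volume (conv f φ) u ≤
      (∫⁻ x, ‖f x‖ₑ) *
        (ENNReal.ofReal t * ENNReal.ofReal c + ∫⁻ x, ENNReal.ofReal (|φ x| - c)) := by
    intro c hc
    have hprod : ENNReal.ofReal ((∫⁻ x, ‖f x‖ₑ).toReal * c) =
        (∫⁻ x, ‖f x‖ₑ) * ENNReal.ofReal c := by
      rw [ENNReal.ofReal_mul ENNReal.toReal_nonneg, ENNReal.ofReal_toReal hfin]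
    have hH : Measurable fun x => ∫⁻ y, ‖f (x - y)‖ₑ * ENNReal.ofReal (|φ y| - c) :=
      Measurable.lintegral_prod_right' (f := fun p : _ × _ =>
        ‖f (p.1 - p.2)‖ₑ * ENNReal.ofReal (|φ p.2| - c)) (by fun_prop)
    refine (setLIntegral_rearr_le_of_enorm_le_add volume hH
      (mul_nonneg ENNReal.toReal_nonneg hc)
      (fun x => hprod ▸ enorm_conv_le_add hf c x) t).trans_eq ?_
    rw [hprod, lintegral_lintegral_sub_mul (F := fun x => ‖f x‖ₑ) (by fun_prop) (by fun_prop)]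
    ring
  rcases setLIntegral_rearr_eq_top_or_exists_le volume hφ ht with htop | ⟨c, hc, hle⟩
  · rcases eq_or_ne (∫⁻ x, ‖f x‖ₑ) 0 with h0 | h0
    · simpa [h0] using key 0 le_rfl
    · simp [htop, ENNReal.mul_top h0]
  · exact (key c hc).trans (by gcongr)

/-- If `|f| ≤ β` everywhere and `f` vanishes outside a measurable set `E` of
Lebesgue measure `r`, then for every `t > 0`, `(f∗φ)**(t) ≤ β r φ**(t)`. -/
theorem conv_maxFn_le_of_bounded_support_at_t (n : ℕ)
    (f φ : EuclideanSpace ℝ (Fin n) → ℝ) (hf : Measurable f) (hφ : Measurable φ)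
    (β r : ℝ) (hβ : ∀ x, |f x| ≤ β)
    (E : Set (EuclideanSpace ℝ (Fin n))) (hE : MeasurableSet E)
    (hr : 0 ≤ r) (hEr : volume E = ENNReal.ofReal r)
    (hfE : ∀ x ∉ E, f x = 0)
    (t : ℝ) (ht : 0 < t) :
    maxFn volume (conv f φ) t ≤
      ENNReal.ofReal β * ENNReal.ofReal r * maxFn volume φ t := by
  have hF : ∫⁻ x, ‖f x‖ₑ ≤ ENNReal.ofReal β * ENNReal.ofReal r := by
    calc ∫⁻ x, ‖f x‖ₑ ≤ ∫⁻ x, E.indicator (fun _ => ENNReal.ofReal β) x := by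
          refine lintegral_mono fun x => ?_
          by_cases hx : x ∈ E
          · rw [indicator_of_mem hx, Real.enorm_eq_ofReal_abs]
            exact ENNReal.ofReal_le_ofReal (hβ x)
          · simp [hfE x hx]
      _ = _ := by rw [lintegral_indicator_const hE, hEr]
  have hfin : ∫⁻ x, ‖f x‖ₑ ≠ ⊤ :=
    ne_top_of_le_ne_top (ENNReal.mul_ne_top ENNReal.ofReal_ne_top ENNReal.ofReal_ne_top) hF
  unfold maxFn
  rw [mul_left_comm]
  gcongr
  exact (setLIntegral_rearr_conv_le hf hφ hfin ht).trans (by gcongr)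
end

section
/- If f and φ are Lebesgue-measurable functions on ℝⁿ, then for every t > 0, (f∗φ)**(t) ≤ ∫_t^∞ f**(s) φ**(s) ds. -/
open MeasureTheory Set
open scoped ENNReal

/-- Layer-cake representation of an extended nonnegative number, with strict inequality. -/
lemma lintegral_Ioi_indicator_ofReal_lt (y : ℝ≥0∞) (c : NNReal) :
    ∫⁻ a in Ioi (c : ℝ), {a : ℝ | ENNReal.ofReal a < y + c}.indicator 1 a = y := by
  have hm : MeasurableSet {a : ℝ | ENNReal.ofReal a < y + c} :=
    measurableSet_lt ENNReal.measurable_ofReal measurable_const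
  rw [lintegral_indicator_one hm, Measure.restrict_apply hm]
  induction y with
  | top =>
    have : {a : ℝ | ENNReal.ofReal a < ⊤ + c} ∩ Ioi (c : ℝ) = Ioi (c : ℝ) := by
      ext a; simp
    rw [this, Real.volume_Ioi]
  | coe y =>
    have : {a : ℝ | ENNReal.ofReal a < y + c} ∩ Ioi (c : ℝ) = Ioo (c : ℝ) (y + c : ℝ) := by
      ext a
      simp only [mem_inter_iff, mem_ofPred_eq, mem_Ioi, mem_Ioo]
      rw [and_comm]
      refine and_congr_right fun ha => ?_
      rw [← ENNReal.coe_add, ENNReal.ofReal_lt_iff_lt_toReal (c.coe_nonneg.trans ha.le)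
        ENNReal.coe_ne_top, ENNReal.coe_toReal, NNReal.coe_add]
    rw [this, Real.volume_Ioo, add_sub_cancel_right, ENNReal.ofReal_coe_nnreal]

lemma lintegral_indicator_ofReal_lt (y : ℝ≥0∞) :
    ∫⁻ a in Ioi (0 : ℝ), {a : ℝ | ENNReal.ofReal a < y}.indicator 1 a = y := by
  simpa using lintegral_Ioi_indicator_ofReal_lt y 0

/-- Layer-cake representation of an extended nonnegative number, with weak inequality. -/
lemma lintegral_indicator_ofReal_le (y : ℝ≥0∞) :
    ∫⁻ a in Ioi (0 : ℝ), {a : ℝ | ENNReal.ofReal a ≤ y}.indicator 1 a = y := by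
  have hm : MeasurableSet {a : ℝ | ENNReal.ofReal a ≤ y} :=
    measurableSet_le ENNReal.measurable_ofReal measurable_const
  rw [lintegral_indicator_one hm, Measure.restrict_apply hm]
  induction y with
  | top =>
    have : {a : ℝ | ENNReal.ofReal a ≤ ⊤} ∩ Ioi 0 = Ioi 0 := by
      ext a; simp
    rw [this, Real.volume_Ioi]
  | coe y =>
    have : {a : ℝ | ENNReal.ofReal a ≤ y} ∩ Ioi 0 = Ioc 0 (y : ℝ) := by
      ext a
      simp only [mem_inter_iff, mem_ofPred_eq, mem_Ioi, mem_Ioc]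
      rw [and_comm]
      refine and_congr_right fun ha => ?_
      rw [ENNReal.ofReal_le_iff_le_toReal ENNReal.coe_ne_top, ENNReal.coe_toReal]
    rw [this, Real.volume_Ioc, sub_zero, ENNReal.ofReal_coe_nnreal]

section Rearrangement

variable {X : Type*} [MeasurableSpace X] (μ : Measure X) (f : X → ℝ)

lemma distrib_antitone_s4 : Antitone (distrib μ f) := fun _ _ h =>
  measure_mono fun _ hx => lt_of_le_of_lt h hx

lemma measurable_distrib : Measurable (distrib μ f) := (distrib_antitone_s4 μ f).measurable

/-- The decreasing rearrangement is the generalized inverse of the distribution function. -/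
lemma rearr_eq_lintegral (u : ℝ) :
    rearr μ f u =
      ∫⁻ a in Ioi (0 : ℝ), {a : ℝ | ENNReal.ofReal u < distrib μ f a}.indicator 1 a := by
  apply le_antisymm
  · rw [← lintegral_indicator_ofReal_lt (rearr μ f u)]
    refine setLIntegral_mono' measurableSet_Ioi fun a ha => ?_
    by_cases hle : distrib μ f a ≤ ENNReal.ofReal u
    · have : rearr μ f u ≤ ENNReal.ofReal a := iInf₂_le a ⟨ha, hle⟩
      simp [this]
    · rw [indicator_of_mem (show a ∈ {a | ENNReal.ofReal u < distrib μ f a} from not_le.1 hle)]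
      exact indicator_le_self _ _ _
  · conv_rhs => rw [← lintegral_indicator_ofReal_le (rearr μ f u)]
    refine lintegral_mono fun a => ?_
    refine indicator_le_indicator_of_subset (fun b hb => ?_) (fun _ => zero_le) a
    refine le_iInf₂ fun s hs => ENNReal.ofReal_le_ofReal ?_
    by_contra! hlt
    exact absurd (lt_of_lt_of_le hb (distrib_antitone_s4 μ f hlt.le)) hs.2.not_gt

lemma lintegral_rearr_eq (t : ℝ) :
    ∫⁻ u in Ioc (0 : ℝ) t, rearr μ f u =
      ∫⁻ a in Ioi (0 : ℝ), min (ENNReal.ofReal t) (distrib μ f a) := by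
  have hm : MeasurableSet {p : ℝ × ℝ | ENNReal.ofReal p.1 < distrib μ f p.2} :=
    measurableSet_lt (ENNReal.measurable_ofReal.comp measurable_fst)
      ((measurable_distrib μ f).comp measurable_snd)
  simp_rw [rearr_eq_lintegral]
  rw [lintegral_lintegral_swap]
  swap
  · exact (measurable_one.indicator hm).aemeasurable
  refine lintegral_congr fun a => ?_
  rw [← lintegral_indicator_ofReal_lt (min (ENNReal.ofReal t) (distrib μ f a)),
    ← restrict_Ioo_eq_restrict_Ioc, ← lintegral_indicator measurableSet_Ioo,
    ← lintegral_indicator measurableSet_Ioi]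
  refine lintegral_congr fun u => ?_
  by_cases h0 : 0 < u <;> by_cases ht : u < t <;>
    by_cases h : ENNReal.ofReal u < distrib μ f a <;>
    simp [indicator, h0, ht, h, ENNReal.ofReal_lt_ofReal_iff_of_nonneg, le_of_lt]

/-- Splitting `|f|` into an integrable and a bounded part controls the integral of `f*`. -/
lemma lintegral_rearr_le_of_le_add [SFinite μ] {g : X → ℝ≥0∞} (hg : Measurable g) (c : ℝ≥0∞)
    (h : ∀ x, ENNReal.ofReal |f x| ≤ g x + c) {t : ℝ} (ht : 0 < t) :
    ∫⁻ u in Ioc (0 : ℝ) t, rearr μ f u ≤ ∫⁻ x, g x ∂μ + ENNReal.ofReal t * c := by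
  induction c with
  | top => simp [ENNReal.mul_top, ht]
  | coe c =>
  have hm : MeasurableSet {p : X × ℝ | ENNReal.ofReal p.2 < g p.1 + c} :=
    measurableSet_lt (ENNReal.measurable_ofReal.comp measurable_snd)
      ((hg.comp measurable_fst).add_const _)
  rw [lintegral_rearr_eq, ← Ioc_union_Ioi_eq_Ioi c.coe_nonneg, add_comm]
  refine (lintegral_union_le _ _ _).trans (add_le_add ?_ ?_)
  · refine (lintegral_mono fun a => min_le_left _ _).trans ?_
    simp
  · calc ∫⁻ a in Ioi (c : ℝ), min (ENNReal.ofReal t) (distrib μ f a)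
        ≤ ∫⁻ a in Ioi (c : ℝ), ∫⁻ x, {a : ℝ | ENNReal.ofReal a < g x + c}.indicator 1 a ∂μ := by
          refine setLIntegral_mono' measurableSet_Ioi fun a ha => (min_le_right _ _).trans ?_
          have hma : MeasurableSet {x | ENNReal.ofReal a < g x + c} :=
            measurableSet_lt measurable_const (hg.add_const _)
          have hsub : distrib μ f a ≤ μ {x | ENNReal.ofReal a < g x + c} :=
            measure_mono fun x hx => lt_of_lt_of_le
              ((ENNReal.ofReal_lt_ofReal_iff_of_nonneg (c.coe_nonneg.trans ha.le)).2 hx) (h x)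
          rw [← lintegral_indicator_one hma] at hsub
          exact hsub
      _ = ∫⁻ x, (∫⁻ a in Ioi (c : ℝ),
          {a : ℝ | ENNReal.ofReal a < g x + c}.indicator 1 a) ∂μ :=
          lintegral_lintegral_swap
            ((measurable_one.indicator hm).comp measurable_swap).aemeasurable
      _ ≤ ∫⁻ x, g x ∂μ :=
          lintegral_mono fun x => (lintegral_Ioi_indicator_ofReal_lt (g x) c).le

end Rearrangement

lemma inv_ofReal_le_lintegral_Ioi {N : ℝ} (hN : 0 < N) :
    (ENNReal.ofReal N)⁻¹ ≤
      ∫⁻ s in Ioi N, (ENNReal.ofReal s)⁻¹ * (ENNReal.ofReal s)⁻¹ := by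
  have hi := integrableOn_Ioi_rpow_of_lt (a := -2) (by norm_num) hN
  have hv := integral_Ioi_rpow_of_lt (a := -2) (by norm_num) hN
  have : (ENNReal.ofReal N)⁻¹ = ∫⁻ s in Ioi N, ENNReal.ofReal (s ^ (-2 : ℝ)) := by
    rw [← ofReal_integral_eq_lintegral_ofReal hi, hv, ← ENNReal.ofReal_inv_of_pos hN]
    · norm_num [Real.rpow_neg_one]
    · filter_upwards [ae_restrict_mem measurableSet_Ioi] with s hs
      exact Real.rpow_nonneg (hN.trans hs).le _
  rw [this]
  refine setLIntegral_mono' measurableSet_Ioi fun s hs => ?_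
  have hs0 : 0 < s := hN.trans hs
  rw [← ENNReal.ofReal_inv_of_pos hs0, ← ENNReal.ofReal_mul (by positivity),
    Real.rpow_neg hs0.le, ← mul_inv, Real.rpow_two, sq]

/-- The kernel `∫_t^∞ s⁻² min(s, α) min(s, β) ds`, bounded below by its tail from `N`. -/
lemma min_mul_min_div_le_lintegral (α β : ℝ≥0∞) {t N : ℝ} (ht : 0 < t) (hN : t ≤ N) :
    (ENNReal.ofReal N)⁻¹ * (min (ENNReal.ofReal N) α * min (ENNReal.ofReal N) β) ≤
      ∫⁻ s in Ioi t, ((ENNReal.ofReal s)⁻¹ * (ENNReal.ofReal s)⁻¹) *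
        (min (ENNReal.ofReal s) α * min (ENNReal.ofReal s) β) := by
  have hmeas : Measurable fun s : ℝ => (ENNReal.ofReal s)⁻¹ * (ENNReal.ofReal s)⁻¹ := by fun_prop
  calc _ ≤ (∫⁻ s in Ioi N, (ENNReal.ofReal s)⁻¹ * (ENNReal.ofReal s)⁻¹) *
        (min (ENNReal.ofReal N) α * min (ENNReal.ofReal N) β) := by
        gcongr; exact inv_ofReal_le_lintegral_Ioi (ht.trans_le hN)
    _ = ∫⁻ s in Ioi N, ((ENNReal.ofReal s)⁻¹ * (ENNReal.ofReal s)⁻¹) *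
        (min (ENNReal.ofReal N) α * min (ENNReal.ofReal N) β) :=
        (lintegral_mul_const _ hmeas).symm
    _ ≤ ∫⁻ s in Ioi N, ((ENNReal.ofReal s)⁻¹ * (ENNReal.ofReal s)⁻¹) *
        (min (ENNReal.ofReal s) α * min (ENNReal.ofReal s) β) := by
        refine setLIntegral_mono' measurableSet_Ioi fun s hs => ?_
        have := ENNReal.ofReal_le_ofReal (le_of_lt (mem_Ioi.1 hs))
        gcongr
    _ ≤ _ := lintegral_mono_set (Ioi_subset_Ioi hN)

lemma min_le_lintegral (α β : ℝ≥0∞) {t : ℝ} (ht : 0 < t)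
    (h : ENNReal.ofReal t < max α β) :
    min α β ≤ ∫⁻ s in Ioi t, ((ENNReal.ofReal s)⁻¹ * (ENNReal.ofReal s)⁻¹) *
        (min (ENNReal.ofReal s) α * min (ENNReal.ofReal s) β) := by
  wlog hαβ : α ≤ β generalizing α β
  · have := this β α (by rwa [max_comm]) (le_of_not_ge hαβ)
    simpa only [min_comm α β, mul_comm (min _ α)] using this
  rw [max_eq_right hαβ] at h
  rw [min_eq_left hαβ]
  refine le_of_forall_lt_imp_le_of_dense fun c hc => ?_
  set N := max t c.toReal
  have hN : ENNReal.ofReal N = max (ENNReal.ofReal t) c := by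
    rw [ENNReal.ofReal_max, ENNReal.ofReal_toReal hc.ne_top]
  have hN0 : ENNReal.ofReal N ≠ 0 := by simp [N, ht]
  have hNβ : ENNReal.ofReal N ≤ β := hN ▸ max_le h.le (hc.le.trans hαβ)
  have hcN : c ≤ ENNReal.ofReal N := hN ▸ le_max_right _ _
  refine le_trans ?_ (min_mul_min_div_le_lintegral α β ht (le_max_left t c.toReal))
  rw [min_eq_left hNβ, mul_comm (min _ α), ← mul_assoc,
    ENNReal.inv_mul_cancel hN0 ENNReal.ofReal_ne_top, one_mul]
  exact le_min hcN hc.le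

section Convolution

variable {n : ℕ} {f φ : EuclideanSpace ℝ (Fin n) → ℝ}

/-- The convolution of the indicators of the superlevel sets of `|f|` at height `p.1` and of `|φ|`
at height `p.2`. -/
noncomputable def levelConv (f φ : EuclideanSpace ℝ (Fin n) → ℝ) (p : ℝ × ℝ)
    (x : EuclideanSpace ℝ (Fin n)) : ℝ≥0∞ :=
  volume {y | p.1 < |f (x - y)| ∧ p.2 < |φ y|}

lemma measurableSet_levelConv (hf : Measurable f) (hφ : Measurable φ) :
    MeasurableSet {q : ((ℝ × ℝ) × EuclideanSpace ℝ (Fin n)) × EuclideanSpace ℝ (Fin n) |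
      q.1.1.1 < |f (q.1.2 - q.2)| ∧ q.1.1.2 < |φ q.2|} := by
  have h1 : Measurable fun q : ((ℝ × ℝ) × EuclideanSpace ℝ (Fin n)) × EuclideanSpace ℝ (Fin n) =>
      |f (q.1.2 - q.2)| :=
    continuous_abs.measurable.comp (hf.comp (by fun_prop))
  have h2 : Measurable fun q : ((ℝ × ℝ) × EuclideanSpace ℝ (Fin n)) × EuclideanSpace ℝ (Fin n) =>
      |φ q.2| :=
    continuous_abs.measurable.comp (hφ.comp (by fun_prop))
  exact (measurableSet_lt (by fun_prop) h1).inter (measurableSet_lt (by fun_prop) h2)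

lemma measurable_levelConv (hf : Measurable f) (hφ : Measurable φ) :
    Measurable (Function.uncurry (levelConv f φ)) :=
  measurable_measure_prodMk_left (measurableSet_levelConv hf hφ)

lemma measurableSet_lt_abs (hf : Measurable f) (a : ℝ) : MeasurableSet {x | a < |f x|} :=
  measurableSet_lt measurable_const (continuous_abs.measurable.comp hf)

lemma levelConv_le_min (hf : Measurable f) (p : ℝ × ℝ) (x : EuclideanSpace ℝ (Fin n)) :
    levelConv f φ p x ≤ min (distrib volume f p.1) (distrib volume φ p.2) := by
  refine le_min ?_ (measure_mono fun y hy => hy.2)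
  rw [distrib, ← (Measure.measurePreserving_sub_left volume x).measure_preimage
    (measurableSet_lt_abs hf p.1).nullMeasurableSet]
  exact measure_mono fun y hy => hy.1

lemma lintegral_levelConv (hf : Measurable f) (hφ : Measurable φ) (p : ℝ × ℝ) :
    ∫⁻ x, levelConv f φ p x = distrib volume f p.1 * distrib volume φ p.2 := by
  have hS : MeasurableSet {q : EuclideanSpace ℝ (Fin n) × EuclideanSpace ℝ (Fin n) |
      p.1 < |f (q.1 - q.2)| ∧ p.2 < |φ q.2|} :=
    (measurableSet_levelConv hf hφ).preimage
      (f := fun q : EuclideanSpace ℝ (Fin n) × EuclideanSpace ℝ (Fin n) => ((p, q.1), q.2))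
      (by fun_prop)
  have key := (Measure.prod_apply (μ := volume) (ν := volume) hS).symm.trans
    (Measure.prod_apply_symm hS)
  refine key.trans ?_
  have (y : EuclideanSpace ℝ (Fin n)) :
      volume ((fun x => (x, y)) ⁻¹' {q : EuclideanSpace ℝ (Fin n) × EuclideanSpace ℝ (Fin n) |
        p.1 < |f (q.1 - q.2)| ∧ p.2 < |φ q.2|}) =
      {y | p.2 < |φ y|}.indicator (fun _ => distrib volume f p.1) y := by
    by_cases hy : p.2 < |φ y|
    · rw [indicator_of_mem (show y ∈ {y | p.2 < |φ y|} from hy), distrib,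
        ← (measurePreserving_sub_right volume y).measure_preimage
          (measurableSet_lt_abs hf p.1).nullMeasurableSet]
      simp [hy]
    · simp [hy]
  simp_rw [this]
  rw [lintegral_indicator_const (measurableSet_lt_abs hφ p.2)]
  rfl

lemma ofReal_abs_conv_le (hf : Measurable f) (hφ : Measurable φ) (x : EuclideanSpace ℝ (Fin n)) :
    ENNReal.ofReal |conv f φ x| ≤
      ∫⁻ p, levelConv f φ p x
        ∂((volume.restrict (Ioi (0 : ℝ))).prod (volume.restrict (Ioi (0 : ℝ)))) := by
  have hS : MeasurableSet {q : EuclideanSpace ℝ (Fin n) × (ℝ × ℝ) |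
      q.2.1 < |f (x - q.1)| ∧ q.2.2 < |φ q.1|} :=
    (measurableSet_levelConv hf hφ).preimage
      (f := fun q : EuclideanSpace ℝ (Fin n) × (ℝ × ℝ) => ((q.2, x), q.1)) (by fun_prop)
  have hm (u : ℝ) : AEMeasurable ({a : ℝ | a < u}.indicator (1 : ℝ → ℝ≥0∞))
      (volume.restrict (Ioi 0)) :=
    (measurable_one.indicator measurableSet_Iio).aemeasurable
  have hind (u : ℝ) : ∫⁻ a in Ioi (0 : ℝ), {a : ℝ | a < |u|}.indicator 1 a = ‖u‖ₑ := by
    rw [Real.enorm_eq_ofReal_abs, ← lintegral_indicator_ofReal_lt (ENNReal.ofReal |u|)]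
    refine setLIntegral_congr_fun measurableSet_Ioi fun a ha => ?_
    simp only [indicator, mem_ofPred_eq, ENNReal.ofReal_lt_ofReal_iff_of_nonneg (le_of_lt ha)]
  calc ENNReal.ofReal |conv f φ x| = ‖conv f φ x‖ₑ := (Real.enorm_eq_ofReal_abs _).symm
    _ ≤ ∫⁻ y, ‖f (x - y) * φ y‖ₑ := enorm_integral_le_lintegral_enorm _
    _ = ∫⁻ y, (∫⁻ p, {p : ℝ × ℝ | p.1 < |f (x - y)| ∧ p.2 < |φ y|}.indicator 1 p
          ∂((volume.restrict (Ioi (0 : ℝ))).prod (volume.restrict (Ioi (0 : ℝ))))) := by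
        refine lintegral_congr fun y => ?_
        rw [enorm_mul, ← hind, ← hind, ← lintegral_prod_mul (hm _) (hm _)]
        refine lintegral_congr fun p => ?_
        by_cases h1 : p.1 < |f (x - y)| <;> by_cases h2 : p.2 < |φ y| <;> simp [h1, h2]
    _ = ∫⁻ p, (∫⁻ y, {y | p.1 < |f (x - y)| ∧ p.2 < |φ y|}.indicator 1 y)
          ∂((volume.restrict (Ioi (0 : ℝ))).prod (volume.restrict (Ioi (0 : ℝ)))) :=
        lintegral_lintegral_swap (measurable_one.indicator hS).aemeasurable
    _ = _ := by
        refine lintegral_congr fun p => ?_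
        exact lintegral_indicator_one (measurable_prodMk_right (y := p) hS)

end Convolution

/-- For measurable `f, φ` on ℝⁿ and `t > 0`,
`(f∗φ)**(t) ≤ ∫_t^∞ f**(s) φ**(s) ds`. -/
theorem conv_maxFn_le_integral_maxFn (n : ℕ)
    (f φ : EuclideanSpace ℝ (Fin n) → ℝ) (hf : Measurable f) (hφ : Measurable φ)
    (t : ℝ) (ht : 0 < t) :
    maxFn volume (conv f φ) t ≤
      ∫⁻ s in Set.Ioi t, maxFn volume f s * maxFn volume φ s := by
  set ρ : Measure (ℝ × ℝ) := (volume.restrict (Ioi (0 : ℝ))).prod (volume.restrict (Ioi (0 : ℝ)))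
  have hF : Measurable fun p : ℝ × ℝ => distrib volume f p.1 :=
    (measurable_distrib _ _).comp measurable_fst
  have hG : Measurable fun p : ℝ × ℝ => distrib volume φ p.2 :=
    (measurable_distrib _ _).comp measurable_snd
  set P : Set (ℝ × ℝ) :=
    {p | max (distrib volume f p.1) (distrib volume φ p.2) ≤ ENNReal.ofReal t}
  have hP : MeasurableSet P := measurableSet_le (hF.max hG) measurable_const
  have hk := measurable_levelConv hf hφ
  set I : ℝ × ℝ → ℝ≥0∞ := fun p =>
    ∫⁻ s in Ioi t, ((ENNReal.ofReal s)⁻¹ * (ENNReal.ofReal s)⁻¹) *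
      (min (ENNReal.ofReal s) (distrib volume f p.1) *
        min (ENNReal.ofReal s) (distrib volume φ p.2)) with hI
  have hrhs : ∫⁻ s in Ioi t, maxFn volume f s * maxFn volume φ s = ∫⁻ p, I p ∂ρ := by
    rw [hI, lintegral_lintegral_swap]
    · refine lintegral_congr fun s => ?_
      rw [lintegral_const_mul _ (by fun_prop), maxFn, maxFn,
        lintegral_rearr_eq, lintegral_rearr_eq, mul_mul_mul_comm, lintegral_prod_mul
          (measurable_const.min (measurable_distrib _ _)).aemeasurable
          (measurable_const.min (measurable_distrib _ _)).aemeasurable]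
    · refine Measurable.aemeasurable ?_
      have h1 := hF.comp (measurable_fst : Measurable (Prod.fst : (ℝ × ℝ) × ℝ → ℝ × ℝ))
      have h2 := hG.comp (measurable_fst : Measurable (Prod.fst : (ℝ × ℝ) × ℝ → ℝ × ℝ))
      simp only [Function.comp_def] at h1 h2
      unfold Function.uncurry
      fun_prop
  have hsplit (x : EuclideanSpace ℝ (Fin n)) : ENNReal.ofReal |conv f φ x| ≤
      ∫⁻ p in P, levelConv f φ p x ∂ρ +
        ∫⁻ p in Pᶜ, min (distrib volume f p.1) (distrib volume φ p.2) ∂ρ := by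
    refine (ofReal_abs_conv_le hf hφ x).trans ?_
    rw [← lintegral_add_compl _ hP]
    gcongr with p
    exact levelConv_le_min hf p x
  have hbound := lintegral_rearr_le_of_le_add volume (conv f φ)
    (g := fun x => ∫⁻ p in P, levelConv f φ p x ∂ρ)
    (hk.lintegral_prod_left') _ hsplit ht
  have hswap : ∫⁻ x, ∫⁻ p in P, levelConv f φ p x ∂ρ =
      ∫⁻ p in P, distrib volume f p.1 * distrib volume φ p.2 ∂ρ := by
    rw [← lintegral_lintegral_swap hk.aemeasurable]
    simp_rw [lintegral_levelConv hf hφ]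
  have ht0 : ENNReal.ofReal t ≠ 0 := by simpa using ht
  rw [hswap] at hbound
  rw [hrhs, maxFn]
  calc _ ≤ _ := mul_le_mul_right hbound _
    _ = ∫⁻ p in P, (ENNReal.ofReal t)⁻¹ * (distrib volume f p.1 * distrib volume φ p.2) ∂ρ +
        ∫⁻ p in Pᶜ, min (distrib volume f p.1) (distrib volume φ p.2) ∂ρ := by
        rw [mul_add, ← mul_assoc, ENNReal.inv_mul_cancel ht0 ENNReal.ofReal_ne_top, one_mul,
          lintegral_const_mul _ (by fun_prop)]
    _ ≤ ∫⁻ p in P, I p ∂ρ + ∫⁻ p in Pᶜ, I p ∂ρ := by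
        refine add_le_add (setLIntegral_mono' hP fun p hp => ?_)
          (setLIntegral_mono' hP.compl fun p hp => ?_)
        · have := min_mul_min_div_le_lintegral (distrib volume f p.1) (distrib volume φ p.2)
            ht le_rfl
          rwa [min_eq_right ((le_max_left _ _).trans hp),
            min_eq_right ((le_max_right _ _).trans hp)] at this
        · exact min_le_lintegral _ _ ht (not_le.1 hp)
    _ = ∫⁻ p, I p ∂ρ := lintegral_add_compl _ hP
end
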